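/- Let a, b, c, d : ℝ² → ℝ be smooth functions, regarded as the components L¹¹¹ = a, L¹¹² = b, L¹²² = c, L²²² = d of a symmetric contravariant tensor of valence three on the Euclidean plane. Then (a,b,c,d) satisfies the valence-three Killing tensor equations for the Euclidean metric, namely ∂ₓa = 0, ∂_y a + 3 ∂ₓ b = 0, ∂_y b + ∂ₓ c = 0, 3 ∂_y c + ∂ₓ d = 0, ∂_y d = 0 at every point (x,y) ∈ ℝ², if and only if there exist ten real constants a₁, a₂, a₃, a₄, α₁, α₂, α₃, β₁, β₂, γ such that for all (x,y) ∈ ℝ²: a(x,y) = a₁ + 3α₁ y + 3β₁ y² + γ y³, b(x,y) = a₂ + α₂ y − α₁ x − 2β₁ x y + β₂ y² − γ x y², c(x,y) = a₃ − α₂ x − α₃ y − 2β₂ x y + β₁ x² + γ x² y, d(x,y) = a₄ + 3α₃ x + 3β₂ x² − γ x³. -/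

import Mathlib

/- STATEMENT 0: A smooth quadruple (a,b,c,d) of components of a symmetric valence-three
tensor on the Euclidean plane satisfies the Killing tensor equations iff it is given by
the ten-parameter general solution. -/

noncomputable section

/-- Partial derivative with respect to the first Cartesian coordinate. -/
def pdx (f : ℝ × ℝ → ℝ) (p : ℝ × ℝ) : ℝ := fderiv ℝ f p (1, 0)

/-- Partial derivative with respect to the second Cartesian coordinate. -/
def pdy (f : ℝ × ℝ → ℝ) (p : ℝ × ℝ) : ℝ := fderiv ℝ f p (0, 1)

theorem hasDerivAt_pdx {f : ℝ × ℝ → ℝ} (hf : Differentiable ℝ f) (x y : ℝ) :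
    HasDerivAt (fun t => f (t, y)) (pdx f (x, y)) x :=
  (hf (x, y)).hasFDerivAt.comp_hasDerivAt x ((hasDerivAt_id x).prodMk (hasDerivAt_const x y))

theorem hasDerivAt_pdy {f : ℝ × ℝ → ℝ} (hf : Differentiable ℝ f) (x y : ℝ) :
    HasDerivAt (fun t => f (x, t)) (pdy f (x, y)) y :=
  (hf (x, y)).hasFDerivAt.comp_hasDerivAt y ((hasDerivAt_const y x).prodMk (hasDerivAt_id y))

theorem hasDerivAt_cubic (k p q r t : ℝ) :
    HasDerivAt (fun t => k + p * t + q * t ^ 2 + r * t ^ 3) (p + 2 * q * t + 3 * r * t ^ 2) t := by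
  have h := ((((hasDerivAt_id t).const_mul p).const_add k).add
    ((hasDerivAt_pow 2 t).const_mul q)).add ((hasDerivAt_pow 3 t).const_mul r)
  refine (h.congr_deriv ?_).congr_of_eventuallyEq (.of_forall fun s => ?_)
  · norm_num
    ring
  · simp

/-- A function with quadratic derivative is the corresponding cubic polynomial. -/
theorem eq_cubic_of_hasDerivAt {f : ℝ → ℝ} (p q r : ℝ)
    (h : ∀ t, HasDerivAt f (p + 2 * q * t + 3 * r * t ^ 2) t) (t : ℝ) :
    f t = f 0 + p * t + q * t ^ 2 + r * t ^ 3 := by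
  have hd : ∀ s, HasDerivAt (fun s => f s - (0 + p * s + q * s ^ 2 + r * s ^ 3)) 0 s := fun s =>
    ((h s).sub (hasDerivAt_cubic 0 p q r s)).congr_deriv (sub_self _)
  have := is_const_of_deriv_eq_zero (fun s => (hd s).differentiableAt) (fun s => (hd s).deriv) t 0
  norm_num at this
  linarith

/-- A function with constant derivative is affine. -/
theorem eq_affine_of_hasDerivAt {f : ℝ → ℝ} {m : ℝ} (h : ∀ t, HasDerivAt f m t) (t : ℝ) :
    f t = f 0 + m * t := by
  have := eq_cubic_of_hasDerivAt m 0 0 (fun s => (h s).congr_deriv (by ring)) t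
  linarith

theorem ContDiff.hasDerivAt_deriv_deriv {f : ℝ → ℝ} (hf : ContDiff ℝ (⊤ : ℕ∞) f) (t : ℝ) :
    HasDerivAt (deriv f) (deriv (deriv f) t) t :=
  ((contDiff_infty_iff_deriv.1 hf).2.differentiable (by simp) t).hasDerivAt

/-- A function with affine second derivative is the corresponding cubic polynomial. -/
theorem eq_cubic_of_deriv_deriv {f : ℝ → ℝ} (hf : ContDiff ℝ (⊤ : ℕ∞) f) (m k : ℝ)
    (h : ∀ t, deriv (deriv f) t = m + k * t) (t : ℝ) :
    deriv f t = deriv f 0 + m * t + k / 2 * t ^ 2 ∧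
      f t = f 0 + deriv f 0 * t + m / 2 * t ^ 2 + k / 6 * t ^ 3 := by
  have h1 : ∀ s, deriv f s = deriv f 0 + m * s + k / 2 * s ^ 2 := fun s => by
    have := eq_cubic_of_hasDerivAt m (k / 2) 0
      (fun u => (hf.hasDerivAt_deriv_deriv u).congr_deriv (by rw [h]; ring)) s
    linarith
  refine ⟨h1 t, eq_cubic_of_hasDerivAt _ _ _ (fun s => ?_) t⟩
  exact (hf.differentiable (by simp) s).hasDerivAt.congr_deriv (by rw [h1]; ring)

theorem killing_tensor_valence_three_general_solution
    (a b c d : ℝ × ℝ → ℝ)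
    (ha : ContDiff ℝ (⊤ : ℕ∞) a) (hb : ContDiff ℝ (⊤ : ℕ∞) b)
    (hc : ContDiff ℝ (⊤ : ℕ∞) c) (hd : ContDiff ℝ (⊤ : ℕ∞) d) :
    (∀ p : ℝ × ℝ,
        pdx a p = 0 ∧
        pdy a p + 3 * pdx b p = 0 ∧
        pdy b p + pdx c p = 0 ∧
        3 * pdy c p + pdx d p = 0 ∧
        pdy d p = 0) ↔
    (∃ a₁ a₂ a₃ a₄ α₁ α₂ α₃ β₁ β₂ γ : ℝ, ∀ x y : ℝ,
        a (x, y) = a₁ + 3 * α₁ * y + 3 * β₁ * y ^ 2 + γ * y ^ 3 ∧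
        b (x, y) = a₂ + α₂ * y - α₁ * x - 2 * β₁ * x * y + β₂ * y ^ 2 - γ * x * y ^ 2 ∧
        c (x, y) = a₃ - α₂ * x - α₃ * y - 2 * β₂ * x * y + β₁ * x ^ 2 + γ * x ^ 2 * y ∧
        d (x, y) = a₄ + 3 * α₃ * x + 3 * β₂ * x ^ 2 - γ * x ^ 3) := by
  have hda := ha.differentiable (by simp)
  have hdb := hb.differentiable (by simp)
  have hdc := hc.differentiable (by simp)
  have hdd := hd.differentiable (by simp)
  constructor
  · intro h
    have hA : ContDiff ℝ (⊤ : ℕ∞) (fun t => a (0, t)) := ha.comp (contDiff_const.prodMk contDiff_id)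
    have hD : ContDiff ℝ (⊤ : ℕ∞) (fun t => d (t, 0)) := hd.comp (contDiff_id.prodMk contDiff_const)
    set A := fun t => a (0, t)
    set D := fun t => d (t, 0)
    have eA : ∀ x y, a (x, y) = A y := fun x y => by
      simpa using eq_affine_of_hasDerivAt
        (fun t => (hasDerivAt_pdx hda t y).congr_deriv (h (t, y)).1) x
    have eD : ∀ x y, d (x, y) = D x := fun x y => by
      simpa using eq_affine_of_hasDerivAt
        (fun t => (hasDerivAt_pdy hdd x t).congr_deriv (h (x, t)).2.2.2.2) y
    have pA : ∀ x y, pdy a (x, y) = deriv A y := fun x y => by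
      rw [← (hasDerivAt_pdy hda x y).deriv]
      simp_rw [eA]
    have pD : ∀ x y, pdx d (x, y) = deriv D x := fun x y => by
      rw [← (hasDerivAt_pdx hdd x y).deriv]
      simp_rw [eD]
    have eb : ∀ x y, b (x, y) = b (0, y) + -(deriv A y) / 3 * x := fun x y =>
      eq_affine_of_hasDerivAt (fun t => (hasDerivAt_pdx hdb t y).congr_deriv
        (by linarith [(h (t, y)).2.1, pA t y])) x
    have ec : ∀ x y, c (x, y) = c (x, 0) + -(deriv D x) / 3 * y := fun x y =>
      eq_affine_of_hasDerivAt (fun t => (hasDerivAt_pdy hdc x t).congr_deriv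
        (by linarith [(h (x, t)).2.2.2.1, pD x t])) y
    have pb : ∀ x y, pdy b (x, y) = pdy b (0, y) + -(deriv (deriv A) y) / 3 * x := fun x y => by
      refine (hasDerivAt_pdy hdb x y).unique ?_
      simp_rw [eb x]
      exact (hasDerivAt_pdy hdb 0 y).add (((hA.hasDerivAt_deriv_deriv y).neg.div_const 3).mul_const x)
    have pc : ∀ x y, pdx c (x, y) = pdx c (x, 0) + -(deriv (deriv D) x) / 3 * y := fun x y => by
      refine (hasDerivAt_pdx hdc x y).unique ?_
      simp_rw [ec _ y]
      exact (hasDerivAt_pdx hdc x 0).add (((hD.hasDerivAt_deriv_deriv x).neg.div_const 3).mul_const y)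
    have key : ∀ x y, pdy b (0, y) + -(deriv (deriv A) y) / 3 * x
        + (pdx c (x, 0) + -(deriv (deriv D) x) / 3 * y) = 0 := fun x y => by
      rw [← pb, ← pc]
      exact (h (x, y)).2.2.1
    have k00 := key 0 0
    set A₂ := deriv (deriv A) 0
    set D₂ := deriv (deriv D) 0
    set k := deriv (deriv A) 1 - A₂ with hk
    have hA₂ : ∀ y, deriv (deriv A) y = A₂ + k * y := fun y => by
      linear_combination (-3) * key 1 y + 3 * key 0 y + 3 * key 1 0 - 3 * key 0 0
        + y * (3 * key 1 1 - 3 * key 0 1 - 3 * key 1 0 + 3 * key 0 0)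
    have hD₂ : ∀ x, deriv (deriv D) x = D₂ + (-k) * x := fun x => by
      linear_combination (-3) * key x 1 + 3 * key x 0 + 3 * key 0 1 - 3 * key 0 0
    have hB : ∀ y, b (0, y) = b (0, 0) + pdy b (0, 0) * y + D₂ / 6 * y ^ 2 + 0 * y ^ 3 :=
      eq_cubic_of_hasDerivAt _ _ _ (fun t => (hasDerivAt_pdy hdb 0 t).congr_deriv
        (by linear_combination key 0 t - key 0 0))
    have hC : ∀ x, c (x, 0) = c (0, 0) + -pdy b (0, 0) * x + A₂ / 6 * x ^ 2 + 0 * x ^ 3 :=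
      eq_cubic_of_hasDerivAt _ _ _ (fun t => (hasDerivAt_pdx hdc t 0).congr_deriv
        (by linear_combination key t 0))
    refine ⟨A 0, b (0, 0), c (0, 0), D 0, deriv A 0 / 3, pdy b (0, 0), deriv D 0 / 3,
      A₂ / 6, D₂ / 6, k / 6, fun x y => ?_⟩
    obtain ⟨A1, A0⟩ := eq_cubic_of_deriv_deriv hA _ _ hA₂ y
    obtain ⟨D1, D0⟩ := eq_cubic_of_deriv_deriv hD _ _ hD₂ x
    refine ⟨?_, ?_, ?_, ?_⟩
    · rw [eA, A0]; ring
    · rw [eb, hB, A1]; ring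
    · rw [ec, hC, D1]; ring
    · rw [eD, D0]; ring
  · rintro ⟨a₁, a₂, a₃, a₄, α₁, α₂, α₃, β₁, β₂, γ, h⟩ ⟨x, y⟩
    have ax : pdx a (x, y) = 0 := (hasDerivAt_pdx hda x y).unique <| by
      simp_rw [fun t => (h t y).1]
      exact hasDerivAt_const _ _
    have dy : pdy d (x, y) = 0 := (hasDerivAt_pdy hdd x y).unique <| by
      simp_rw [fun t => (h x t).2.2.2]
      exact hasDerivAt_const _ _
    have ay := (hasDerivAt_pdy hda x y).unique <|
      (hasDerivAt_cubic a₁ (3 * α₁) (3 * β₁) γ y).congr_of_eventuallyEq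
        (.of_forall fun t => (h x t).1)
    have bx := (hasDerivAt_pdx hdb x y).unique <|
      (hasDerivAt_cubic (a₂ + α₂ * y + β₂ * y ^ 2) (-α₁ - 2 * β₁ * y - γ * y ^ 2) 0 0
        x).congr_of_eventuallyEq (.of_forall fun t => (h t y).2.1.trans (by ring))
    have b_y := (hasDerivAt_pdy hdb x y).unique <|
      (hasDerivAt_cubic (a₂ - α₁ * x) (α₂ - 2 * β₁ * x) (β₂ - γ * x) 0
        y).congr_of_eventuallyEq (.of_forall fun t => (h x t).2.1.trans (by ring))
    have cx := (hasDerivAt_pdx hdc x y).unique <|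
      (hasDerivAt_cubic (a₃ - α₃ * y) (-α₂ - 2 * β₂ * y) (β₁ + γ * y) 0
        x).congr_of_eventuallyEq (.of_forall fun t => (h t y).2.2.1.trans (by ring))
    have cy := (hasDerivAt_pdy hdc x y).unique <|
      (hasDerivAt_cubic (a₃ - α₂ * x + β₁ * x ^ 2) (-α₃ - 2 * β₂ * x + γ * x ^ 2) 0 0
        y).congr_of_eventuallyEq (.of_forall fun t => (h x t).2.2.1.trans (by ring))
    have dx := (hasDerivAt_pdx hdd x y).unique <|
      (hasDerivAt_cubic a₄ (3 * α₃) (3 * β₂) (-γ) x).congr_of_eventuallyEq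
        (.of_forall fun t => (h t y).2.2.2.trans (by ring))
    refine ⟨ax, ?_, ?_, ?_, dy⟩
    · rw [ay, bx]; ring
    · rw [b_y, cx]; ring
    · rw [cy, dx]; ring
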